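/- arXiv:1908.04198 — 12 statements merged into one kernel-verified Lean document; each statement's English description precedes it below -/
import Mathlib

section
/- Let x, y, a, b, c, d, e, f be eight distinct propositional variables and let NE(x,y) be the set of nine clauses {x,a,b}, {y,c,d}, {y,e,f}, {c,e,f}, {b,c,e}, {a,c,f}, {a,d,e}, {a,b,d}, {b,d,f}. Then a truth assignment β for {x,y} can be extended to a truth assignment β' for {x,y,a,b,c,d,e,f} that nae-satisfies all nine clauses of NE(x,y) if and only if β(x) ≠ β(y). -/
/-- A 3-clause is nae-satisfied: at least one literal evaluates to true and
at least one evaluates to false. -/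
def naeSat (p q r : Bool) : Prop := (p || q || r) = true ∧ (p && q && r) = false

instance (p q r : Bool) : Decidable (naeSat p q r) :=
  inferInstanceAs (Decidable (_ ∧ _))

/-- The truth-value form of the gadget: suitable values of the six auxiliary variables exist
exactly when the two terminals disagree. -/
theorem exists_naeSat_iff_ne : ∀ x y : Bool,
    (∃ a b c d e f : Bool,
      naeSat x a b ∧ naeSat y c d ∧ naeSat y e f ∧ naeSat c e f ∧ naeSat b c e ∧
      naeSat a c f ∧ naeSat a d e ∧ naeSat a b d ∧ naeSat b d f) ↔ x ≠ y := by
  decide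

theorem stmt_0 {V : Type} (x y a b c d e f : V)
    (hdist : List.Pairwise (· ≠ ·) [x, y, a, b, c, d, e, f])
    (βx βy : Bool) :
    (∃ β' : V → Bool, β' x = βx ∧ β' y = βy ∧
        naeSat (β' x) (β' a) (β' b) ∧
        naeSat (β' y) (β' c) (β' d) ∧
        naeSat (β' y) (β' e) (β' f) ∧
        naeSat (β' c) (β' e) (β' f) ∧
        naeSat (β' b) (β' c) (β' e) ∧
        naeSat (β' a) (β' c) (β' f) ∧
        naeSat (β' a) (β' d) (β' e) ∧
        naeSat (β' a) (β' b) (β' d) ∧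
        naeSat (β' b) (β' d) (β' f)) ↔ βx ≠ βy := by
  classical
  rw [← exists_naeSat_iff_ne]
  constructor
  · rintro ⟨β, rfl, rfl, h⟩
    exact ⟨β a, β b, β c, β d, β e, β f, h⟩
  · rintro ⟨va, vb, vc, vd, ve, vf, h⟩
    let β : V → Bool := fun v =>
      if v = x then βx else if v = y then βy else if v = a then va else if v = b then vb
      else if v = c then vc else if v = d then vd else if v = e then ve else vf
    simp only [List.pairwise_cons, List.mem_cons, forall_eq_or_imp, List.not_mem_nil] at hdist
    have hx : β x = βx := by grind
    have hy : β y = βy := by grind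
    have ha : β a = va := by grind
    have hb : β b = vb := by grind
    have hc : β c = vc := by grind
    have hd : β d = vd := by grind
    have he : β e = ve := by grind
    have hf : β f = vf := by grind
    refine ⟨β, hx, hy, ?_⟩
    rwa [hx, hy, ha, hb, hc, hd, he, hf]
end

section
/- Let x, y and a, b, c, d, e, f, g, h, i be eleven distinct propositional variables and let EQ(x,y) be the set of thirteen clauses {x,a,b}, {y,c,d}, {y,e,f}, {a,c,g}, {a,e,d}, {a,h,i}, {b,e,h}, {b,f,h}, {b,g,i}, {c,e,i}, {c,f,g}, {d,g,h}, {d,f,i}. Then a truth assignment β for {x,y} can be extended to a truth assignment β' for {x,y,a,b,c,d,e,f,g,h,i} that nae-satisfies all thirteen clauses of EQ(x,y) if and only if β(x) = β(y). -/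
theorem stmt_1 {V : Type} (x y a b c d e f g h i : V)
    (hdist : List.Pairwise (· ≠ ·) [x, y, a, b, c, d, e, f, g, h, i])
    (βx βy : Bool) :
    (∃ β' : V → Bool, β' x = βx ∧ β' y = βy ∧
        naeSat (β' x) (β' a) (β' b) ∧
        naeSat (β' y) (β' c) (β' d) ∧
        naeSat (β' y) (β' e) (β' f) ∧
        naeSat (β' a) (β' c) (β' g) ∧
        naeSat (β' a) (β' e) (β' d) ∧
        naeSat (β' a) (β' h) (β' i) ∧
        naeSat (β' b) (β' e) (β' h) ∧
        naeSat (β' b) (β' f) (β' h) ∧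
        naeSat (β' b) (β' g) (β' i) ∧
        naeSat (β' c) (β' e) (β' i) ∧
        naeSat (β' c) (β' f) (β' g) ∧
        naeSat (β' d) (β' g) (β' h) ∧
        naeSat (β' d) (β' f) (β' i)) ↔ βx = βy := by
  constructor
  · rintro ⟨β', rfl, rfl, h⟩
    clear hdist
    revert h
    generalize β' x = x, β' y = y, β' a = a, β' b = b, β' c = c, β' d = d, β' e = e,
      β' f = f, β' g = g, β' h = h, β' i = i
    unfold naeSat
    clear β'
    grind
  · rintro rfl
    classical
    refine ⟨fun v => if v = a ∨ v = b ∨ v = c ∨ v = d ∨ v = f then !βx else βx, ?_⟩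
    simp only [List.pairwise_cons, List.mem_cons, List.not_mem_nil, or_false, ne_eq,
      forall_eq_or_imp, forall_eq] at hdist
    cases βx <;> simp_all [naeSat, eq_comm]
end

section
/- Let x, y, z, u and a, b, c, d, e, f be ten distinct propositional variables and let EQ(x,y,z,u) be the set of twelve clauses {x,a,e}, {x,b,d}, {x,c,f}, {y,a,b}, {y,c,e}, {y,d,f}, {z,a,f}, {z,c,d}, {z,u,b}, {u,a,c}, {u,d,e}, {b,e,f}. Then (1) a truth assignment β for {x,y,z,u} can be extended to a truth assignment β' for {x,y,z,u,a,b,c,d,e,f} that nae-satisfies all twelve clauses of EQ(x,y,z,u) if and only if β(x) = β(y) = β(z) = β(u); and (2) EQ(x,y,z,u) is linear, i.e., every two distinct clauses of EQ(x,y,z,u) share at most one variable. -/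
/-- The clauses of the gadget EQ(x,y,z,u), as finsets of variables. -/
def EQclauses {V : Type} [DecidableEq V] (x y z u a b c d e f : V) :
    List (Finset V) :=
  [{x, a, e}, {x, b, d}, {x, c, f}, {y, a, b}, {y, c, e}, {y, d, f},
   {z, a, f}, {z, c, d}, {z, u, b}, {u, a, c}, {u, d, e}, {b, e, f}]

theorem naeSat_iff (p q r : Bool) : naeSat p q r ↔ ¬(p = q ∧ q = r) := by
  unfold naeSat
  revert p q r
  decide

theorem EQclauses_map {V W : Type} [DecidableEq V] [DecidableEq W] (g : W ↪ V)
    (x y z u a b c d e f : W) :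
    EQclauses (g x) (g y) (g z) (g u) (g a) (g b) (g c) (g d) (g e) (g f) =
      (EQclauses x y z u a b c d e f).map (Finset.map g) := by
  simp [EQclauses]

set_option maxRecDepth 20000 in
theorem EQclauses_fin_linear :
    ∀ c₁ ∈ EQclauses (0 : Fin 10) 1 2 3 4 5 6 7 8 9,
      ∀ c₂ ∈ EQclauses (0 : Fin 10) 1 2 3 4 5 6 7 8 9, c₁ ≠ c₂ → (c₁ ∩ c₂).card ≤ 1 := by
  decide

theorem stmt_2 {V : Type} [DecidableEq V] (x y z u a b c d e f : V)
    (hdist : List.Pairwise (· ≠ ·) [x, y, z, u, a, b, c, d, e, f]) :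
    (∀ βx βy βz βu : Bool,
      (∃ β' : V → Bool, β' x = βx ∧ β' y = βy ∧ β' z = βz ∧ β' u = βu ∧
          naeSat (β' x) (β' a) (β' e) ∧
          naeSat (β' x) (β' b) (β' d) ∧
          naeSat (β' x) (β' c) (β' f) ∧
          naeSat (β' y) (β' a) (β' b) ∧
          naeSat (β' y) (β' c) (β' e) ∧
          naeSat (β' y) (β' d) (β' f) ∧
          naeSat (β' z) (β' a) (β' f) ∧
          naeSat (β' z) (β' c) (β' d) ∧
          naeSat (β' z) (β' u) (β' b) ∧
          naeSat (β' u) (β' a) (β' c) ∧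
          naeSat (β' u) (β' d) (β' e) ∧
          naeSat (β' b) (β' e) (β' f)) ↔ (βx = βy ∧ βy = βz ∧ βz = βu))
    ∧
    (∀ c₁ ∈ EQclauses x y z u a b c d e f, ∀ c₂ ∈ EQclauses x y z u a b c d e f,
      c₁ ≠ c₂ → (c₁ ∩ c₂).card ≤ 1) := by
  constructor
  · intro βx βy βz βu
    constructor
    · rintro ⟨β', rfl, rfl, rfl, rfl, h⟩
      simp only [naeSat_iff] at h
      generalize β' x = x, β' y = y, β' z = z, β' u = u, β' a = a, β' b = b, β' c = c,
        β' d = d, β' e = e, β' f = f at h ⊢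
      cases a <;> cases b <;> cases c <;> cases d <;> cases e <;> cases f <;> simp at h ⊢ <;> grind
    · rintro ⟨rfl, rfl, rfl⟩
      simp only [naeSat_iff]
      refine ⟨fun v => if v = a ∨ v = b ∨ v = c ∨ v = d then !βx else βx, ?_⟩
      simp only [List.pairwise_cons, List.forall_mem_cons] at hdist
      simp [hdist, Ne.symm]
  · let g : Fin 10 ↪ V :=
      ⟨[x, y, z, u, a, b, c, d, e, f].get, List.nodup_iff_injective_get.1 hdist⟩
    have h : EQclauses x y z u a b c d e f =
        (EQclauses (0 : Fin 10) 1 2 3 4 5 6 7 8 9).map (Finset.map g) :=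
      EQclauses_map g 0 1 2 3 4 5 6 7 8 9
    rw [h]
    simp only [List.mem_map]
    rintro _ ⟨s, hs, rfl⟩ _ ⟨t, ht, rfl⟩ hne
    rw [← Finset.map_inter, Finset.card_map]
    exact EQclauses_fin_linear s hs t ht fun hst => hne (hst ▸ rfl)
end

section
/- Let x, a, b, c, d, e, f, a', b', c', d', e', f' be thirteen distinct propositional variables. Then the following set of twenty-six clauses is unsatisfiable: {x,a,b}, {x,c,d}, {x,e,f}, {a,c,f}, {a,d,e}, {b,c,e}, {b,d,f}, {¬a,¬c,¬f}, {¬a,¬d,¬e}, {¬a,¬e,¬f}, {¬b,¬c,¬d}, {¬b,¬c,¬e}, {¬b,¬d,¬f}, {¬x,¬a',¬b'}, {¬x,¬c',¬d'}, {¬x,¬e',¬f'}, {¬a',¬c',¬f'}, {¬a',¬d',¬e'}, {¬b',¬c',¬e'}, {¬b',¬d',¬f'}, {a',c',f'}, {a',d',e'}, {a',e',f'}, {b',c',d'}, {b',c',e'}, {b',d',f'}. (In this set every variable appears exactly three times unnegated and exactly three times negated, so it witnesses an unsatisfiable instance of Monotone 3-Sat-(3,3).) -/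
/-- A 3-clause is satisfied: at least one literal evaluates to true. -/
def clauseSat (p q r : Bool) : Prop := (p || q || r) = true

/-- The half of the clause set without primed variables forces the shared variable to be true. -/
theorem eq_true_of_half_clauseSat : ∀ x a b c d e f : Bool,
    (x || a || b) = true → (x || c || d) = true → (x || e || f) = true →
    (a || c || f) = true → (a || d || e) = true → (b || c || e) = true →
    (b || d || f) = true →
    (!a || !c || !f) = true → (!a || !d || !e) = true → (!a || !e || !f) = true →
    (!b || !c || !d) = true → (!b || !c || !e) = true → (!b || !d || !f) = true →
    x = true := by
  decide

theorem stmt_5 {V : Type} (x a b c d e f a' b' c' d' e' f' : V)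
    (hdist : List.Pairwise (· ≠ ·) [x, a, b, c, d, e, f, a', b', c', d', e', f']) :
    ¬ ∃ β : V → Bool,
        clauseSat (β x) (β a) (β b) ∧
        clauseSat (β x) (β c) (β d) ∧
        clauseSat (β x) (β e) (β f) ∧
        clauseSat (β a) (β c) (β f) ∧
        clauseSat (β a) (β d) (β e) ∧
        clauseSat (β b) (β c) (β e) ∧
        clauseSat (β b) (β d) (β f) ∧
        clauseSat (!β a) (!β c) (!β f) ∧
        clauseSat (!β a) (!β d) (!β e) ∧
        clauseSat (!β a) (!β e) (!β f) ∧
        clauseSat (!β b) (!β c) (!β d) ∧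
        clauseSat (!β b) (!β c) (!β e) ∧
        clauseSat (!β b) (!β d) (!β f) ∧
        clauseSat (!β x) (!β a') (!β b') ∧
        clauseSat (!β x) (!β c') (!β d') ∧
        clauseSat (!β x) (!β e') (!β f') ∧
        clauseSat (!β a') (!β c') (!β f') ∧
        clauseSat (!β a') (!β d') (!β e') ∧
        clauseSat (!β b') (!β c') (!β e') ∧
        clauseSat (!β b') (!β d') (!β f') ∧
        clauseSat (β a') (β c') (β f') ∧
        clauseSat (β a') (β d') (β e') ∧
        clauseSat (β a') (β e') (β f') ∧
        clauseSat (β b') (β c') (β d') ∧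
        clauseSat (β b') (β c') (β e') ∧
        clauseSat (β b') (β d') (β f') := by
  rintro ⟨β, h₁, h₂, h₃, h₄, h₅, h₆, h₇, h₈, h₉, h₁₀, h₁₁, h₁₂, h₁₃,
    k₁, k₂, k₃, k₄, k₅, k₆, k₇, k₈, k₉, k₁₀, k₁₁, k₁₂, k₁₃⟩
  have hx : β x = true := eq_true_of_half_clauseSat _ _ _ _ _ _ _
    h₁ h₂ h₃ h₄ h₅ h₆ h₇ h₈ h₉ h₁₀ h₁₁ h₁₂ h₁₃
  have hx' : (!β x) = true := by
    apply eq_true_of_half_clauseSat (!β x) (!β a') (!β b') (!β c') (!β d') (!β e') (!β f')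
      k₁ k₂ k₃ k₄ k₅ k₆ k₇ <;> simpa only [Bool.not_not]
  simp [hx] at hx'
end

section
/- Let x1, x2, x3, x4, x5, x6 be propositional variables (not necessarily distinct) and a, b, c, d, e, f, g, h, i be nine further distinct propositional variables not among x1,…,x6, and let D(x1,…,x6) be the set of clauses {¬a,¬c,¬e}, {¬b,¬f,¬h}, {¬d,¬g,¬i}, {a,b,d}, {a,d,f}, {a,f,i}, {a,h,i}, {b,c,d}, {b,c,g}, {b,e,g}, {c,g,h}, {c,h,i}, {e,f,g}, {e,f,i}, {a,g,x1}, {b,i,x2}, {c,f,x3}, {d,e,x4}, {d,h,x5}, {e,h,x6}. Then a truth assignment β for {x1,…,x6} can be extended to a truth assignment β' for {x1,…,x6,a,b,c,d,e,f,g,h,i} that satisfies all clauses of D(x1,…,x6) if and only if β(v) = T for at least one v ∈ {x1,…,x6}. -/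
/-- Any assignment can be overridden with prescribed values at pairwise distinct variables. -/
theorem exists_override {V W : Type*} (β : V → W) (l : List (V × W))
    (hl : (l.map Prod.fst).Pairwise (· ≠ ·)) :
    ∃ β' : V → W, (∀ p ∈ l, β' p.1 = p.2) ∧ ∀ s, (∀ t ∈ l.map Prod.fst, t ≠ s) → β' s = β s := by
  classical
  induction l with
  | nil => exact ⟨β, by simp, fun _ _ => rfl⟩
  | cons p l ih =>
    rw [List.map_cons, List.pairwise_cons] at hl
    obtain ⟨β', hset, hrest⟩ := ih hl.2
    refine ⟨Function.update β' p.1 p.2, fun q hq => ?_, fun s hs => ?_⟩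
    · rcases List.mem_cons.mp hq with rfl | hq
      · simp
      · rw [Function.update_of_ne (hl.1 q.1 (List.mem_map_of_mem hq)).symm, hset q hq]
    · rw [List.map_cons, List.forall_mem_cons] at hs
      rw [Function.update_of_ne hs.1.symm, hrest s hs.2]

theorem stmt_8 {V : Type} (x₁ x₂ x₃ x₄ x₅ x₆ a b c d e f g h i : V)
    (hdist : List.Pairwise (· ≠ ·) [a, b, c, d, e, f, g, h, i])
    (hfresh : ∀ t ∈ [a, b, c, d, e, f, g, h, i],
        ∀ s ∈ [x₁, x₂, x₃, x₄, x₅, x₆], t ≠ s)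
    (β : V → Bool) :
    (∃ β' : V → Bool,
        β' x₁ = β x₁ ∧ β' x₂ = β x₂ ∧ β' x₃ = β x₃ ∧
        β' x₄ = β x₄ ∧ β' x₅ = β x₅ ∧ β' x₆ = β x₆ ∧
        clauseSat (!β' a) (!β' c) (!β' e) ∧
        clauseSat (!β' b) (!β' f) (!β' h) ∧
        clauseSat (!β' d) (!β' g) (!β' i) ∧
        clauseSat (β' a) (β' b) (β' d) ∧
        clauseSat (β' a) (β' d) (β' f) ∧
        clauseSat (β' a) (β' f) (β' i) ∧
        clauseSat (β' a) (β' h) (β' i) ∧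
        clauseSat (β' b) (β' c) (β' d) ∧
        clauseSat (β' b) (β' c) (β' g) ∧
        clauseSat (β' b) (β' e) (β' g) ∧
        clauseSat (β' c) (β' g) (β' h) ∧
        clauseSat (β' c) (β' h) (β' i) ∧
        clauseSat (β' e) (β' f) (β' g) ∧
        clauseSat (β' e) (β' f) (β' i) ∧
        clauseSat (β' a) (β' g) (β' x₁) ∧
        clauseSat (β' b) (β' i) (β' x₂) ∧
        clauseSat (β' c) (β' f) (β' x₃) ∧
        clauseSat (β' d) (β' e) (β' x₄) ∧
        clauseSat (β' d) (β' h) (β' x₅) ∧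
        clauseSat (β' e) (β' h) (β' x₆)) ↔
      (β x₁ = true ∨ β x₂ = true ∨ β x₃ = true ∨
       β x₄ = true ∨ β x₅ = true ∨ β x₆ = true) := by
  constructor
  · rintro ⟨β', h₁, h₂, h₃, h₄, h₅, h₆, hclauses⟩
    rw [← h₁, ← h₂, ← h₃, ← h₄, ← h₅, ← h₆]
    unfold clauseSat at hclauses
    grind
  · intro hβ
    have key (ta tb tc td te tf tg th ti : Bool) : ∃ β' : V → Bool,
        (β' a = ta ∧ β' b = tb ∧ β' c = tc ∧ β' d = td ∧ β' e = te ∧ β' f = tf ∧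
          β' g = tg ∧ β' h = th ∧ β' i = ti) ∧
        β' x₁ = β x₁ ∧ β' x₂ = β x₂ ∧ β' x₃ = β x₃ ∧
        β' x₄ = β x₄ ∧ β' x₅ = β x₅ ∧ β' x₆ = β x₆ := by
      obtain ⟨β', hset, hrest⟩ := exists_override β
        [(a, ta), (b, tb), (c, tc), (d, td), (e, te), (f, tf), (g, tg), (h, th), (i, ti)] hdist
      have hx (s : V) (hs : s ∈ [x₁, x₂, x₃, x₄, x₅, x₆]) : β' s = β s :=
        hrest s fun t ht => hfresh t ht s hs
      refine ⟨β', by simpa using hset, ?_⟩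
      simpa using hx
    rcases hβ with hx | hx | hx | hx | hx | hx
    · obtain ⟨β', ⟨ha, hb, hc, hd, he, hf, hg, hh, hi⟩, h₁, h₂, h₃, h₄, h₅, h₆⟩ :=
        key false false true true true false false false true
      exact ⟨β', by simp [clauseSat, *]⟩
    · obtain ⟨β', ⟨ha, hb, hc, hd, he, hf, hg, hh, hi⟩, h₁, h₂, h₃, h₄, h₅, h₆⟩ :=
        key false false false true false true true true false
      exact ⟨β', by simp [clauseSat, *]⟩
    · obtain ⟨β', ⟨ha, hb, hc, hd, he, hf, hg, hh, hi⟩, h₁, h₂, h₃, h₄, h₅, h₆⟩ :=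
        key true true false false true false false true false
      exact ⟨β', by simp [clauseSat, *]⟩
    · obtain ⟨β', ⟨ha, hb, hc, hd, he, hf, hg, hh, hi⟩, h₁, h₂, h₃, h₄, h₅, h₆⟩ :=
        key true false true false false false true true true
      exact ⟨β', by simp [clauseSat, *]⟩
    · obtain ⟨β', ⟨ha, hb, hc, hd, he, hf, hg, hh, hi⟩, h₁, h₂, h₃, h₄, h₅, h₆⟩ :=
        key false true false false true true true false true
      exact ⟨β', by simp [clauseSat, *]⟩
    · obtain ⟨β', ⟨ha, hb, hc, hd, he, hf, hg, hh, hi⟩, h₁, h₂, h₃, h₄, h₅, h₆⟩ :=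
        key true true true true false true false false false
      exact ⟨β', by simp [clauseSat, *]⟩
end

section
/- Let y, u1, u2, u3 be distinct propositional variables and let F(y) = D(y,u1,u1,u1,u1,u1) ∪ D(y,u2,u2,u2,u2,u2) ∪ D(y,u3,u3,u3,u3,u3) ∪ {{¬u1,¬u2,¬u3}}, where each of the three copies of the gadget D uses its own nine fresh auxiliary variables, disjoint from the other copies and from {y,u1,u2,u3}. Then F(y) is satisfiable, and every truth assignment that satisfies all clauses of F(y) assigns the value T to y. -/
/-- The gadget D(x₁,…,x₆) with auxiliary variables a,…,i: its clauses are all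
satisfied under the given truth values (a clause is satisfied if at least one
of its literals evaluates to true). -/
def Dgad (x₁ x₂ x₃ x₄ x₅ x₆ a b c d e f g h i : Bool) : Prop :=
  (!a || !c || !e) = true ∧ (!b || !f || !h) = true ∧ (!d || !g || !i) = true ∧
  (a || b || d) = true ∧ (a || d || f) = true ∧ (a || f || i) = true ∧
  (a || h || i) = true ∧ (b || c || d) = true ∧ (b || c || g) = true ∧
  (b || e || g) = true ∧ (c || g || h) = true ∧ (c || h || i) = true ∧
  (e || f || g) = true ∧ (e || f || i) = true ∧
  (a || g || x₁) = true ∧ (b || i || x₂) = true ∧ (c || f || x₃) = true ∧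
  (d || e || x₄) = true ∧ (d || h || x₅) = true ∧ (e || h || x₆) = true

/-- The gadget F(y) = D(y,u₁,u₁,u₁,u₁,u₁) ∪ D(y,u₂,u₂,u₂,u₂,u₂) ∪
D(y,u₃,u₃,u₃,u₃,u₃) ∪ {{¬u₁,¬u₂,¬u₃}}, where the k-th copy of D uses its own
nine fresh auxiliary variables `w k 0, …, w k 8`. -/
def Fgad (y u₁ u₂ u₃ : Bool) (w : Fin 3 → Fin 9 → Bool) : Prop :=
  Dgad y u₁ u₁ u₁ u₁ u₁
    (w 0 0) (w 0 1) (w 0 2) (w 0 3) (w 0 4) (w 0 5) (w 0 6) (w 0 7) (w 0 8) ∧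
  Dgad y u₂ u₂ u₂ u₂ u₂
    (w 1 0) (w 1 1) (w 1 2) (w 1 3) (w 1 4) (w 1 5) (w 1 6) (w 1 7) (w 1 8) ∧
  Dgad y u₃ u₃ u₃ u₃ u₃
    (w 2 0) (w 2 1) (w 2 2) (w 2 3) (w 2 4) (w 2 5) (w 2 6) (w 2 7) (w 2 8) ∧
  (!u₁ || !u₂ || !u₃) = true

theorem not_Dgad_false (a b c d e f g h i : Bool) :
    ¬ Dgad false false false false false false a b c d e f g h i := by
  unfold Dgad
  cases a <;> cases b <;> cases c <;> cases d <;> cases e <;> cases f <;> cases g <;>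
    cases h <;> simp

theorem stmt_9 :
    (∃ (y u₁ u₂ u₃ : Bool) (w : Fin 3 → Fin 9 → Bool), Fgad y u₁ u₂ u₃ w) ∧
    (∀ (y u₁ u₂ u₃ : Bool) (w : Fin 3 → Fin 9 → Bool),
        Fgad y u₁ u₂ u₃ w → y = true) := by
  refine ⟨⟨true, false, false, false,
    fun _ => ![false, false, true, true, true, false, false, false, true], ?_⟩, ?_⟩
  · simp [Fgad, Dgad]
  · rintro (_ | _) u₁ u₂ u₃ w ⟨h₁, h₂, h₃, hu⟩
    · cases u₁
      · exact absurd h₁ (not_Dgad_false _ _ _ _ _ _ _ _ _)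
      cases u₂
      · exact absurd h₂ (not_Dgad_false _ _ _ _ _ _ _ _ _)
      cases u₃
      · exact absurd h₃ (not_Dgad_false _ _ _ _ _ _ _ _ _)
      simp at hu
    · rfl
end

section
/- Let n = 3k be a positive multiple of 3, let V = {x1,…,xn} be a set of n propositional variables, and consider the set of clauses C = N ∪ C⁺, where N = { {¬x_{3i-2}, ¬x_{3i-1}, ¬x_{3i}} : 1 ≤ i ≤ k } and C⁺ is a set of clauses each consisting of three distinct unnegated variables from V. Then C is satisfiable if and only if there exists a set X ⊆ V containing exactly one variable from each of the k triples {x_{3i-2}, x_{3i-1}, x_{3i}} such that no clause of C⁺ is a subset of X. -/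
/- The n = 3k variables x₁,…,xₙ are encoded as pairs (i, j) : Fin k × Fin 3,
where (i, j) represents the variable x_{3i+j+1}, so that the i-th negative
triple is {(i,0), (i,1), (i,2)}. -/
theorem stmt_11 (k : ℕ) (hk : 0 < k)
    (Cpos : Finset (Finset (Fin k × Fin 3)))
    (hcard : ∀ c ∈ Cpos, c.card = 3) :
    (∃ β : Fin k × Fin 3 → Bool,
        (∀ i : Fin k, ∃ j : Fin 3, β (i, j) = false) ∧
        (∀ c ∈ Cpos, ∃ v ∈ c, β v = true)) ↔
      (∃ X : Finset (Fin k × Fin 3),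
        (∀ i : Fin k, (X.filter (fun v => v.1 = i)).card = 1) ∧
        (∀ c ∈ Cpos, ¬ c ⊆ X)) := by
  constructor
  · rintro ⟨β, hneg, hpos⟩
    choose f hf using hneg
    refine ⟨Finset.univ.image fun i => (i, f i), fun i => ?_, fun c hc hsub => ?_⟩
    · refine Finset.card_eq_one.mpr ⟨(i, f i), ?_⟩
      ext ⟨a, b⟩
      simp only [Finset.mem_filter, Finset.mem_image, Finset.mem_univ, true_and,
        Finset.mem_singleton, Prod.mk.injEq]
      grind
    · obtain ⟨v, hv, hβ⟩ := hpos c hc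
      obtain ⟨i, -, rfl⟩ := Finset.mem_image.mp (hsub hv)
      simp [hf] at hβ
  · rintro ⟨X, hX, hpos⟩
    refine ⟨fun v => decide (v ∉ X), fun i => ?_, fun c hc => ?_⟩
    · obtain ⟨⟨a, b⟩, hv⟩ := Finset.card_pos.mp (by rw [hX i]; exact one_pos)
      obtain ⟨hmem, rfl⟩ := Finset.mem_filter.mp hv
      exact ⟨b, by simpa using hmem⟩
    · obtain ⟨v, hv, hvX⟩ := Finset.not_subset.mp (hpos c hc)
      exact ⟨v, hv, by simpa using hvX⟩
end

section
/- Let n = 3k be a positive multiple of 3, let V = {x1,…,xn} be a set of n propositional variables, and consider the set of clauses C = N ∪ C⁺, where N = { {¬x_{3i-2}, ¬x_{3i-1}, ¬x_{3i}} : 1 ≤ i ≤ k } and C⁺ is a set of clauses each consisting of three distinct unnegated variables from V. If every variable of V occurs in fewer than 81/n clauses of C⁺, then C is satisfiable. -/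
/-- At most a fraction `3 ^ (-#c)` of the functions `ι → Fin 3` have a graph containing `c`. -/
theorem three_pow_card_mul_card_graph_superset_le {ι : Type*} [Fintype ι] [DecidableEq ι]
    (c : Finset (ι × Fin 3)) :
    3 ^ c.card * (Finset.univ.filter (fun f : ι → Fin 3 => ∀ v ∈ c, f v.1 = v.2)).card
      ≤ 3 ^ Fintype.card ι := by
  rcases (Finset.univ.filter (fun f : ι → Fin 3 => ∀ v ∈ c, f v.1 = v.2)).eq_empty_or_nonempty
    with h | ⟨g, hg⟩
  · rw [h, Finset.card_empty, mul_zero]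
    exact Nat.zero_le _
  · have hg' : ∀ v ∈ c, g v.1 = v.2 := by simpa using hg
    have hinj : Set.InjOn Prod.fst (c : Set (ι × Fin 3)) := fun v hv w hw hvw =>
      Prod.ext hvw (by rw [← hg' v hv, ← hg' w hw, hvw])
    have hsub : Finset.univ.filter (fun f : ι → Fin 3 => ∀ v ∈ c, f v.1 = v.2) ⊆
        Fintype.piFinset (fun i => if i ∈ c.image Prod.fst then {g i} else Finset.univ) := by
      intro f hf
      have hf' : ∀ v ∈ c, f v.1 = v.2 := by simpa using hf
      rw [Fintype.mem_piFinset]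
      intro i
      split_ifs with hi
      · obtain ⟨v, hv, rfl⟩ := Finset.mem_image.1 hi
        rw [Finset.mem_singleton, hf' v hv, hg' v hv]
      · exact Finset.mem_univ _
    refine (Nat.mul_le_mul_left _ (Finset.card_le_card hsub)).trans_eq ?_
    have hcard (i : ι) :
        (if i ∈ c.image Prod.fst then ({g i} : Finset (Fin 3)) else Finset.univ).card =
          if i ∈ c.image Prod.fst then 1 else 3 := by
      split_ifs <;> simp
    rw [Fintype.card_piFinset, Finset.prod_congr rfl fun i _ => hcard i, Finset.prod_ite]
    simp only [Finset.prod_const, one_pow, one_mul]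
    rw [← Finset.card_image_of_injOn hinj, ← pow_add, Finset.filter_not,
      Finset.filter_mem_eq_inter, Finset.univ_inter, ← Finset.compl_eq_univ_sdiff,
      Finset.card_add_card_compl]

/-- A 3-uniform family on `3 * k` points in which every point has degree less than
`81 / (3 * k)` has fewer than 27 members. -/
theorem card_lt_of_degree_lt {k : ℕ} (hk : 0 < k) (C : Finset (Finset (Fin k × Fin 3)))
    (hcard : ∀ c ∈ C, c.card = 3)
    (hdeg : ∀ v : Fin k × Fin 3,
      ((C.filter (fun c => v ∈ c)).card : ℚ) < 81 / (3 * k : ℚ)) :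
    C.card < 27 := by
  have hcount : ∑ v : Fin k × Fin 3, (C.filter (fun c => v ∈ c)).card = 3 * C.card := by
    have h := Finset.sum_card_bipartiteAbove_eq_sum_card_bipartiteBelow
      (s := (Finset.univ : Finset (Fin k × Fin 3))) (t := C) (fun v c => v ∈ c)
    simp only [Finset.bipartiteAbove, Finset.bipartiteBelow, Finset.filter_univ_mem] at h
    rw [h, Finset.sum_congr rfl hcard, Finset.sum_const, smul_eq_mul, mul_comm]
  have hk' : (0 : ℚ) < k := by exact_mod_cast hk
  have hlt : ∑ v : Fin k × Fin 3, ((C.filter (fun c => v ∈ c)).card : ℚ) <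
      ∑ _v : Fin k × Fin 3, 81 / (3 * k : ℚ) :=
    Finset.sum_lt_sum_of_nonempty ⟨(⟨0, hk⟩, 0), Finset.mem_univ _⟩ fun v _ => hdeg v
  have htotal : ∑ _v : Fin k × Fin 3, 81 / (3 * k : ℚ) = 81 := by
    simp only [Finset.sum_const, Finset.card_univ, Fintype.card_prod, Fintype.card_fin,
      nsmul_eq_mul, Nat.cast_mul, Nat.cast_ofNat]
    field_simp
  rw [htotal, ← Nat.cast_sum, hcount] at hlt
  have : 3 * C.card < 81 := by exact_mod_cast hlt
  omega


/- The n = 3k variables x₁,…,xₙ are encoded as pairs (i, j) : Fin k × Fin 3,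
where (i, j) represents the variable x_{3i+j+1}, so that the i-th negative
triple is {(i,0), (i,1), (i,2)}. -/
theorem stmt_12 (k : ℕ) (hk : 0 < k)
    (Cpos : Finset (Finset (Fin k × Fin 3)))
    (hcard : ∀ c ∈ Cpos, c.card = 3)
    (happ : ∀ v : Fin k × Fin 3,
        ((Cpos.filter (fun c => v ∈ c)).card : ℚ) < 81 / (3 * k : ℚ)) :
    ∃ β : Fin k × Fin 3 → Bool,
      (∀ i : Fin k, ∃ j : Fin 3, β (i, j) = false) ∧
      (∀ c ∈ Cpos, ∃ v ∈ c, β v = true) := by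
  have hlt := card_lt_of_degree_lt hk Cpos hcard happ
  have hbad : (Cpos.biUnion fun c =>
      Finset.univ.filter (fun f : Fin k → Fin 3 => ∀ v ∈ c, f v.1 = v.2)).card <
      (Finset.univ : Finset (Fin k → Fin 3)).card := by
    have hsum : 27 * (Cpos.biUnion fun c =>
        Finset.univ.filter (fun f : Fin k → Fin 3 => ∀ v ∈ c, f v.1 = v.2)).card ≤
        Cpos.card * 3 ^ k := by
      refine (Nat.mul_le_mul_left _ Finset.card_biUnion_le).trans ?_
      rw [Finset.mul_sum, ← smul_eq_mul]
      refine Finset.sum_le_card_nsmul _ _ _ fun c hc => ?_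
      simpa [hcard c hc] using three_pow_card_mul_card_graph_superset_le c
    have hpos : 0 < 3 ^ k := by positivity
    rw [Finset.card_univ, Fintype.card_fun, Fintype.card_fin, Fintype.card_fin]
    nlinarith
  obtain ⟨f, -, hf⟩ := Finset.exists_mem_notMem_of_card_lt_card hbad
  refine ⟨fun v => decide (f v.1 ≠ v.2), fun i => ⟨f i, by simp⟩, fun c hc => ?_⟩
  by_contra! h
  exact hf (Finset.mem_biUnion.2 ⟨c, hc, by simpa using h⟩)
end

section
/- Let n = 3k be a positive multiple of 3, let V = {x1,…,xn} be a set of n propositional variables, and consider the set of clauses C = N ∪ C⁺, where N = { {¬x_{3i-2}, ¬x_{3i-1}, ¬x_{3i}} : 1 ≤ i ≤ k } and C⁺ is a set of clauses each consisting of three distinct unnegated variables from V. If |C⁺| < 27, then C is satisfiable. -/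
/-- At most a `3⁻³` fraction of the choice functions `f` has a graph containing a given
set of three points. -/
lemma card_filter_graph_mul_le (k : ℕ) (c : Finset (Fin k × Fin 3)) (hc : c.card = 3) :
    (Finset.univ.filter fun f : Fin k → Fin 3 => ∀ v ∈ c, f v.1 = v.2).card * 27 ≤ 3 ^ k := by
  classical
  by_cases hinj : Set.InjOn Prod.fst (c : Set (Fin k × Fin 3))
  · set s := c.image Prod.fst with hs
    have hscard : s.card = 3 := by rw [hs, Finset.card_image_of_injOn hinj, hc]
    let t : Fin k → Finset (Fin 3) := fun i =>
      Finset.univ.filter fun j => ∀ v ∈ c, v.1 = i → j = v.2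
    have hsub : (Finset.univ.filter fun f : Fin k → Fin 3 => ∀ v ∈ c, f v.1 = v.2) ⊆
        Fintype.piFinset t := by
      intro f hf
      simp only [Finset.mem_filter, Finset.mem_univ, true_and] at hf
      simp only [Fintype.mem_piFinset, t, Finset.mem_filter, Finset.mem_univ, true_and]
      rintro i v hv rfl
      exact hf v hv
    have hone : ∀ i ∈ s, (t i).card ≤ 1 := by
      intro i hi
      obtain ⟨v, hv, rfl⟩ := Finset.mem_image.1 hi
      refine Finset.card_le_one.2 fun a ha b hb => ?_
      simp only [t, Finset.mem_filter, Finset.mem_univ, true_and] at ha hb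
      rw [ha v hv rfl, hb v hv rfl]
    have hthree : ∀ i ∈ sᶜ, (t i).card ≤ 3 := fun i _ => by
      simpa using Finset.card_le_univ (t i)
    have hprod : ∏ i, (t i).card ≤ 3 ^ sᶜ.card := by
      rw [← Finset.prod_mul_prod_compl s]
      calc _ ≤ 1 ^ s.card * 3 ^ sᶜ.card :=
            Nat.mul_le_mul (Finset.prod_le_pow_card _ _ _ hone)
              (Finset.prod_le_pow_card _ _ _ hthree)
        _ = _ := by simp
    have hcompl : sᶜ.card + 3 = k := by
      have := Finset.card_compl_add_card s
      rwa [hscard, Fintype.card_fin] at this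
    calc _ ≤ 3 ^ sᶜ.card * 27 := Nat.mul_le_mul_right _
          ((Finset.card_le_card hsub).trans ((Fintype.card_piFinset t).trans_le hprod))
      _ = 3 ^ (sᶜ.card + 3) := by rw [pow_add]; norm_num
      _ = 3 ^ k := by rw [hcompl]
  · have hempty : (Finset.univ.filter fun f : Fin k → Fin 3 => ∀ v ∈ c, f v.1 = v.2) = ∅ := by
      refine Finset.filter_eq_empty_iff.2 fun f _ hf => hinj fun v hv w hw h => ?_
      exact Prod.ext h (by rw [← hf v hv, ← hf w hw, h])
    rw [hempty]
    simp

/- The n = 3k variables x₁,…,xₙ are encoded as pairs (i, j) : Fin k × Fin 3,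
where (i, j) represents the variable x_{3i+j+1}, so that the i-th negative
triple is {(i,0), (i,1), (i,2)}. -/
theorem stmt_13 (k : ℕ) (hk : 0 < k)
    (Cpos : Finset (Finset (Fin k × Fin 3)))
    (hcard : ∀ c ∈ Cpos, c.card = 3)
    (hsize : Cpos.card < 27) :
    ∃ β : Fin k × Fin 3 → Bool,
      (∀ i : Fin k, ∃ j : Fin 3, β (i, j) = false) ∧
      (∀ c ∈ Cpos, ∃ v ∈ c, β v = true) := by
  classical
  obtain ⟨f, hf⟩ : ∃ f : Fin k → Fin 3, ∀ c ∈ Cpos, ∃ v ∈ c, f v.1 ≠ v.2 := by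
    by_contra! hbad
    let B : Finset (Fin k × Fin 3) → Finset (Fin k → Fin 3) := fun c =>
      Finset.univ.filter fun f => ∀ v ∈ c, f v.1 = v.2
    have hcover : (Finset.univ : Finset (Fin k → Fin 3)) ⊆ Cpos.biUnion B := fun f _ => by
      obtain ⟨c, hc, h⟩ := hbad f
      exact Finset.mem_biUnion.2 ⟨c, hc, by simpa [B] using h⟩
    have hle : 3 ^ k ≤ ∑ c ∈ Cpos, (B c).card := by
      simpa using (Finset.card_le_card hcover).trans Finset.card_biUnion_le
    have hsum : (∑ c ∈ Cpos, (B c).card) * 27 ≤ Cpos.card * 3 ^ k := by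
      rw [Finset.sum_mul, ← smul_eq_mul (a := Cpos.card)]
      exact Finset.sum_le_card_nsmul _ _ _ fun c hc => card_filter_graph_mul_le k c (hcard c hc)
    have hpos : 0 < 3 ^ k := by positivity
    nlinarith
  refine ⟨fun v => decide (f v.1 ≠ v.2), fun i => ⟨f i, by simp⟩, fun c hc => ?_⟩
  obtain ⟨v, hv, h⟩ := hf c hc
  exact ⟨v, hv, by simpa using h⟩
end

section
/- Every instance of Monotone 3-Sat-(4,1) with fewer than 21 variables is satisfiable. That is, if V is a set of propositional variables with |V| < 21 and C is a collection of clauses over V such that each clause consists of exactly three distinct variables, either all unnegated or all negated, and every variable of V appears unnegated in exactly four clauses of C and negated in exactly one clause of C, then C is satisfiable. -/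
namespace MonotoneSat

/-- The variable sets of the clauses of sign `b` in `C`. -/
def clausesOfSign {V : Type} [Fintype V] [DecidableEq V] (C : Finset (Finset V × Bool))
    (b : Bool) : Finset (Finset V) :=
  Finset.univ.filter fun s => (s, b) ∈ C

lemma mem_clausesOfSign {V : Type} [Fintype V] [DecidableEq V] {C : Finset (Finset V × Bool)}
    {b : Bool} {s : Finset V} : s ∈ clausesOfSign C b ↔ (s, b) ∈ C := by
  simp [clausesOfSign]

lemma card_filter_clausesOfSign {V : Type} [Fintype V] [DecidableEq V]
    (C : Finset (Finset V × Bool)) (b : Bool) (v : V) :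
    ((clausesOfSign C b).filter (fun s => v ∈ s)).card =
      (C.filter (fun c => c.2 = b ∧ v ∈ c.1)).card := by
  refine Finset.card_nbij' (fun s => (s, b)) Prod.fst ?_ ?_ ?_ ?_
  · intro s hs
    simpa [clausesOfSign] using hs
  · rintro ⟨s, c⟩ hs
    simp only [Finset.coe_filter, Set.mem_ofPred_eq] at hs
    obtain ⟨hC, rfl, hv⟩ := hs
    simpa [clausesOfSign] using ⟨hC, hv⟩
  · intro s _
    rfl
  · rintro ⟨s, c⟩ hs
    simp only [Finset.coe_filter, Set.mem_ofPred_eq] at hs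
    simp [hs.2.1]

/-- If every vertex lies in exactly one of the triples in `N`, then a 3-set is contained in the
range of at most a `1/27` fraction of the choice functions of `N`. -/
lemma card_choice_covering_le {V : Type} [DecidableEq V] (N : Finset (Finset V))
    (hN : ∀ s ∈ N, s.card = 3) (huniq : ∀ v : V, (N.filter (fun s => v ∈ s)).card = 1)
    (p : Finset V) (hp : p.card = 3) :
    27 * ((Fintype.piFinset (fun s : N => s.1)).filter
      (fun f => ∀ v ∈ p, ∃ s, f s = v)).card ≤ 3 ^ N.card := by
  set t : N → Finset V := fun s => s.1.filter (fun x => ∀ v ∈ p, v ∈ s.1 → x = v) with ht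
  have hsub : (Fintype.piFinset (fun s : N => s.1)).filter (fun f => ∀ v ∈ p, ∃ s, f s = v) ⊆
      Fintype.piFinset t := by
    intro f hf
    simp only [Finset.mem_filter, Fintype.mem_piFinset] at hf
    simp only [ht, Fintype.mem_piFinset, Finset.mem_filter]
    refine fun s => ⟨hf.1 s, fun v hv hvs => ?_⟩
    obtain ⟨s', rfl⟩ := hf.2 v hv
    obtain ⟨u, hu⟩ := Finset.card_eq_one.mp (huniq (f s'))
    have h₁ : s.1 ∈ N.filter (fun u => f s' ∈ u) := Finset.mem_filter.mpr ⟨s.2, hvs⟩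
    have h₂ : s'.1 ∈ N.filter (fun u => f s' ∈ u) := Finset.mem_filter.mpr ⟨s'.2, hf.1 s'⟩
    rw [hu, Finset.mem_singleton] at h₁ h₂
    rw [Subtype.ext (h₁.trans h₂.symm)]
  have hpoint : ∀ s : N, 3 ^ (p ∩ s.1).card * (t s).card ≤ 3 := by
    intro s
    have hle : (t s).card ≤ 3 := (Finset.card_filter_le _ _).trans (hN s.1 s.2).le
    rcases Finset.eq_empty_or_nonempty (t s) with he | ⟨x, hx⟩
    · simp [he]
    · have hall : ∀ v ∈ p ∩ s.1, x = v := fun v hv =>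
        (Finset.mem_filter.mp hx).2 v (Finset.mem_inter.mp hv).1 (Finset.mem_inter.mp hv).2
      rcases Finset.eq_empty_or_nonempty (p ∩ s.1) with he | ⟨v, hv⟩
      · simpa [he] using hle
      · have h₁ : (p ∩ s.1).card ≤ 1 :=
          Finset.card_le_one.mpr fun a ha b hb => (hall a ha).symm.trans (hall b hb)
        have h₂ : (t s).card ≤ 1 := by
          refine Finset.card_le_one.mpr fun a ha b hb => ?_
          have hv' := Finset.mem_inter.mp hv
          exact ((Finset.mem_filter.mp ha).2 v hv'.1 hv'.2).trans
            ((Finset.mem_filter.mp hb).2 v hv'.1 hv'.2).symm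
        calc 3 ^ (p ∩ s.1).card * (t s).card ≤ 3 ^ 1 * 1 :=
              Nat.mul_le_mul (Nat.pow_le_pow_right (by norm_num) h₁) h₂
          _ = 3 := by norm_num
  have hsum : ∑ s : N, (p ∩ s.1).card = 3 := by
    rw [Finset.sum_coe_sort N (fun s => (p ∩ s).card),
      Finset.sum_card_inter (n := 1) (fun v _ => huniq v), hp]
  calc _ ≤ 27 * (Fintype.piFinset t).card := Nat.mul_le_mul_left _ (Finset.card_le_card hsub)
    _ = ∏ s : N, 3 ^ (p ∩ s.1).card * (t s).card := by
        rw [Finset.prod_mul_distrib, Finset.prod_pow_eq_pow_sum, hsum, Fintype.card_piFinset]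
        norm_num
    _ ≤ ∏ _s : N, 3 := Finset.prod_le_prod' fun s _ => hpoint s
    _ = 3 ^ N.card := by simp

end MonotoneSat

/- A monotone 3-clause is encoded as a pair (s, sign) where s is the set of its
three (distinct) variables and sign is `true` if the variables occur unnegated
and `false` if they all occur negated. Such a clause is satisfied by a truth
assignment β iff some variable v ∈ s has β v = sign. -/
theorem stmt_14 {V : Type} [Fintype V] [DecidableEq V]
    (hV : Fintype.card V < 21)
    (C : Finset (Finset V × Bool))
    (hcard : ∀ c ∈ C, c.1.card = 3)
    (hpos : ∀ v : V, (C.filter (fun c => c.2 = true ∧ v ∈ c.1)).card = 4)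
    (hneg : ∀ v : V, (C.filter (fun c => c.2 = false ∧ v ∈ c.1)).card = 1) :
    ∃ β : V → Bool, ∀ c ∈ C, ∃ v ∈ c.1, β v = c.2 := by
  set N := MonotoneSat.clausesOfSign C false
  set P := MonotoneSat.clausesOfSign C true
  have hN : ∀ s ∈ N, s.card = 3 := fun s hs => hcard _ (MonotoneSat.mem_clausesOfSign.mp hs)
  have hP : ∀ s ∈ P, s.card = 3 := fun s hs => hcard _ (MonotoneSat.mem_clausesOfSign.mp hs)
  have hN₁ : ∀ v : V, (N.filter (fun s => v ∈ s)).card = 1 := fun v =>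
    (MonotoneSat.card_filter_clausesOfSign C false v).trans (hneg v)
  have hP₄ : ∀ v : V, (P.filter (fun s => v ∈ s)).card = 4 := fun v =>
    (MonotoneSat.card_filter_clausesOfSign C true v).trans (hpos v)
  have hNcard : N.card * 3 = Fintype.card V * 1 := by
    rw [← Finset.sum_card hN₁, Finset.sum_const_nat hN]
  have hPcard : P.card * 3 = Fintype.card V * 4 := by
    rw [← Finset.sum_card hP₄, Finset.sum_const_nat hP]
  obtain ⟨f, hf, hfP⟩ : ∃ f ∈ Fintype.piFinset (fun s : N => s.1),
      ∀ p ∈ P, ¬ ∀ v ∈ p, ∃ s, f s = v := by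
    by_contra! hcon
    have hsub : Fintype.piFinset (fun s : N => s.1) ⊆ P.biUnion fun p =>
        (Fintype.piFinset (fun s : N => s.1)).filter (fun f => ∀ v ∈ p, ∃ s, f s = v) := by
      intro f hf
      obtain ⟨p, hp, hpf⟩ := hcon f hf
      exact Finset.mem_biUnion.mpr ⟨p, hp, Finset.mem_filter.mpr ⟨hf, hpf⟩⟩
    have htotal : (Fintype.piFinset (fun s : N => s.1)).card = 3 ^ N.card := by
      rw [Fintype.card_piFinset, Finset.prod_congr rfl fun s _ => hN s.1 s.2]
      simp
    have hbound : 27 * 3 ^ N.card ≤ P.card * 3 ^ N.card := by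
      rw [← htotal]
      calc _ ≤ 27 * _ := Nat.mul_le_mul_left _
            ((Finset.card_le_card hsub).trans Finset.card_biUnion_le)
        _ ≤ _ := by
          rw [Finset.mul_sum, htotal, ← smul_eq_mul (a := P.card)]
          refine Finset.sum_le_card_nsmul _ _ _ fun p hp => ?_
          refine le_of_eq_of_le ?_ (MonotoneSat.card_choice_covering_le N hN hN₁ p (hP p hp))
          congr!
    have := Nat.le_of_mul_le_mul_right hbound (by positivity)
    omega
  rw [Fintype.mem_piFinset] at hf
  refine ⟨fun v => !decide (∃ s, f s = v), ?_⟩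
  rintro ⟨s, b⟩ hs
  cases b with
  | false =>
    have hsN : s ∈ N := MonotoneSat.mem_clausesOfSign.mpr hs
    exact ⟨f ⟨s, hsN⟩, hf ⟨s, hsN⟩, by simp⟩
  | true =>
    have := hfP s (MonotoneSat.mem_clausesOfSign.mpr hs)
    push Not at this
    obtain ⟨v, hv, hne⟩ := this
    exact ⟨v, hv, by simpa using hne⟩
end

section
/- Every instance of Monotone 3-Sat-(3,1) with fewer than 27 variables is satisfiable. That is, if V is a set of propositional variables with |V| < 27 and C is a collection of clauses over V such that each clause consists of exactly three distinct variables, either all unnegated or all negated, and every variable of V appears unnegated in exactly three clauses of C and negated in exactly one clause of C, then C is satisfiable. -/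
/-- Among the choice functions of a family of `k`-element sets, at most a fraction `k⁻ˢ` selects
all the elements of a prescribed set of size `s`. -/
theorem pow_card_mul_card_filter_piFinset_le {ι α : Type*} [Fintype ι] [DecidableEq ι]
    [DecidableEq α] (k : ℕ) (A : ι → Finset α) (hA : ∀ i, (A i).card = k) (g : α → ι)
    (s : Finset α) :
    k ^ s.card * ((Fintype.piFinset A).filter (fun f => ∀ v ∈ s, f (g v) = v)).card ≤
      k ^ Fintype.card ι := by
  rcases Finset.eq_empty_or_nonempty
    ((Fintype.piFinset A).filter (fun f => ∀ v ∈ s, f (g v) = v)) with h | ⟨f₀, hf₀⟩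
  · simp [h]
  · have hf₀s := (Finset.mem_filter.1 hf₀).2
    have hinj : Set.InjOn g s := fun v hv w hw h => by
      rw [← hf₀s v hv, ← hf₀s w hw, h]
    have hsub : (Fintype.piFinset A).filter (fun f => ∀ v ∈ s, f (g v) = v) ⊆
        Fintype.piFinset (fun i => if i ∈ s.image g then {f₀ i} else A i) := by
      intro f hf
      obtain ⟨hfA, hfs⟩ := Finset.mem_filter.1 hf
      refine Fintype.mem_piFinset.2 fun i => ?_
      split_ifs with hi
      · obtain ⟨v, hv, rfl⟩ := Finset.mem_image.1 hi
        simp [hfs v hv, hf₀s v hv]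
      · exact Fintype.mem_piFinset.1 hfA i
    have hcard : (Fintype.piFinset (fun i => if i ∈ s.image g then {f₀ i} else A i)).card =
        k ^ (s.image g)ᶜ.card := by
      rw [Fintype.card_piFinset, ← Finset.prod_const,
        ← Finset.prod_mul_prod_compl (s.image g), Finset.prod_eq_one, one_mul]
      · refine Finset.prod_congr rfl fun i hi => ?_
        rw [if_neg (Finset.mem_compl.1 hi), hA]
      · intro i hi
        rw [if_pos hi, Finset.card_singleton]
    calc _ ≤ k ^ s.card * k ^ (s.image g)ᶜ.card :=
          Nat.mul_le_mul_left _ ((Finset.card_le_card hsub).trans_eq hcard)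
      _ = k ^ Fintype.card ι := by
          rw [← pow_add, ← Finset.card_image_of_injOn hinj, Finset.card_add_card_compl]

/- A monotone 3-clause is encoded as a pair (s, sign) where s is the set of its
three (distinct) variables and sign is `true` if the variables occur unnegated
and `false` if they all occur negated. Such a clause is satisfied by a truth
assignment β iff some variable v ∈ s has β v = sign. -/
theorem stmt_15 {V : Type} [Fintype V] [DecidableEq V]
    (hV : Fintype.card V < 27)
    (C : Finset (Finset V × Bool))
    (hcard : ∀ c ∈ C, c.1.card = 3)
    (hpos : ∀ v : V, (C.filter (fun c => c.2 = true ∧ v ∈ c.1)).card = 3)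
    (hneg : ∀ v : V, (C.filter (fun c => c.2 = false ∧ v ∈ c.1)).card = 1) :
    ∃ β : V → Bool, ∀ c ∈ C, ∃ v ∈ c.1, β v = c.2 := by
  set P := C.filter (fun c => c.2 = true) with hP
  have hPcard : P.card = Fintype.card V := by
    have h := Finset.sum_card_bipartiteAbove_eq_sum_card_bipartiteBelow
      (s := (Finset.univ : Finset V)) (t := P) (fun v c => v ∈ c.1)
    have h₁ : ∀ v ∈ (Finset.univ : Finset V),
        (Finset.bipartiteAbove (fun v (c : Finset V × Bool) => v ∈ c.1) P v).card = 3 := by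
      intro v _
      rw [Finset.bipartiteAbove, hP, Finset.filter_filter, hpos v]
    have h₂ : ∀ c ∈ P, (Finset.bipartiteBelow (fun v (c : Finset V × Bool) => v ∈ c.1)
        Finset.univ c).card = 3 := by
      intro c hc
      rw [Finset.bipartiteBelow, Finset.filter_univ_mem, hcard c (Finset.mem_filter.1 hc).1]
    rw [Finset.sum_congr rfl h₁, Finset.sum_congr rfl h₂] at h
    simp only [Finset.sum_const, smul_eq_mul, Finset.card_univ] at h
    omega
  have huniq : ∀ v : V, ∃ i : {c // c ∈ C ∧ c.2 = false},
      ∀ j : {c // c ∈ C ∧ c.2 = false}, v ∈ j.1.1 → i = j := by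
    intro v
    obtain ⟨c, hc⟩ := Finset.card_eq_one.1 (hneg v)
    have hmem : c ∈ C.filter (fun c => c.2 = false ∧ v ∈ c.1) := by simp [hc]
    rw [Finset.mem_filter] at hmem
    refine ⟨⟨c, hmem.1, hmem.2.1⟩, fun j hj => Subtype.ext ?_⟩
    have hj' : j.1 ∈ C.filter (fun c => c.2 = false ∧ v ∈ c.1) :=
      Finset.mem_filter.2 ⟨j.2.1, j.2.2, hj⟩
    rw [hc, Finset.mem_singleton] at hj'
    exact hj'.symm
  choose g hg using huniq
  let A : {c // c ∈ C ∧ c.2 = false} → Finset V := fun i => i.1.1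
  have hA : ∀ i, (A i).card = 3 := fun i => hcard i.1 i.2.1
  obtain ⟨f, hfA, hf⟩ : ∃ f ∈ Fintype.piFinset A, ∀ c ∈ P, ∃ v ∈ c.1, f (g v) ≠ v := by
    by_contra! hbad
    have hcover : Fintype.piFinset A ⊆
        P.biUnion fun c => (Fintype.piFinset A).filter (fun f => ∀ v ∈ c.1, f (g v) = v) := by
      intro f hf
      obtain ⟨c, hc, h⟩ := hbad f hf
      exact Finset.mem_biUnion.2 ⟨c, hc, Finset.mem_filter.2 ⟨hf, h⟩⟩
    have hle := (Finset.card_le_card hcover).trans Finset.card_biUnion_le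
    rw [Fintype.card_piFinset, Finset.prod_congr rfl fun i _ => hA i, Finset.prod_const,
      Finset.card_univ] at hle
    have hlt : 27 * 3 ^ Fintype.card {c // c ∈ C ∧ c.2 = false} ≤
        P.card * 3 ^ Fintype.card {c // c ∈ C ∧ c.2 = false} := by
      refine (Nat.mul_le_mul_left 27 hle).trans ?_
      rw [Finset.mul_sum, ← smul_eq_mul (a := P.card)]
      refine Finset.sum_le_card_nsmul _ _ _ fun c hc => ?_
      have h := pow_card_mul_card_filter_piFinset_le 3 A hA g c.1
      rw [hcard c (Finset.mem_filter.1 hc).1, show 3 ^ 3 = 27 from rfl] at h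
      exact le_of_eq_of_le (by congr!) h
    have := Nat.le_of_mul_le_mul_right hlt (by positivity)
    omega
  refine ⟨fun v => decide (f (g v) ≠ v), fun c hc => ?_⟩
  cases hsign : c.2 with
  | true =>
    obtain ⟨v, hv, hne⟩ := hf c (Finset.mem_filter.2 ⟨hc, hsign⟩)
    exact ⟨v, hv, by simpa using hne⟩
  | false =>
    have hmem : f ⟨c, hc, hsign⟩ ∈ c.1 := Fintype.mem_piFinset.1 hfA ⟨c, hc, hsign⟩
    exact ⟨_, hmem, by simp [hg _ ⟨c, hc, hsign⟩ hmem]⟩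
end

section
/- Let x, y, z, u, v, w be distinct propositional variables and let B(x,y,z) = C(u,x) ∪ C(v,y) ∪ C(w,z) ∪ {{¬u,¬v,¬w}}, where each of the three copies of the gadget C uses its own eight fresh auxiliary variables, disjoint from the other copies and from {x,y,z,u,v,w}. Let V be the set of all variables appearing in B(x,y,z). Then a truth assignment β for {x,y,z} can be extended to a truth assignment β' for V that satisfies all clauses of B(x,y,z) if and only if β(v₀) = T for at least one v₀ ∈ {x,y,z}. -/
/-- All clauses of the gadget C(x,y) (with auxiliary variables a,…,h) are
satisfied under the truth assignment β. -/
def Cgad {V : Type} (β : V → Bool) (x y a b c d e f g h : V) : Prop :=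
  clauseSat (!β a) (!β c) (!β e) ∧
  clauseSat (!β a) (!β c) (!β f) ∧
  clauseSat (!β a) (!β d) (!β g) ∧
  clauseSat (!β b) (!β c) (!β h) ∧
  clauseSat (!β b) (!β e) (!β g) ∧
  clauseSat (!β b) (!β f) (!β g) ∧
  clauseSat (!β d) (!β e) (!β h) ∧
  clauseSat (!β d) (!β f) (!β h) ∧
  clauseSat (β a) (β b) (β x) ∧
  clauseSat (β c) (β d) (β x) ∧
  clauseSat (β e) (β f) (β x) ∧
  clauseSat (β g) (β h) (β y)

/-- Values can be prescribed freely along a list of distinct elements. -/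
theorem List.Pairwise.exists_map_eq {α β : Type*} [Inhabited β] {l : List α}
    (hl : l.Pairwise (· ≠ ·)) {vs : List β} (hlen : l.length = vs.length) :
    ∃ f : α → β, l.map f = vs := by
  classical
  induction l generalizing vs with
  | nil => exact ⟨fun _ => default, by simpa [eq_comm] using hlen⟩
  | cons t l ih =>
    cases vs with
    | nil => simp at hlen
    | cons s vs =>
      obtain ⟨ht, hl⟩ := List.pairwise_cons.1 hl
      obtain ⟨f, rfl⟩ := ih hl (by simpa using hlen)
      refine ⟨Function.update f t s, ?_⟩
      rw [List.map_cons, Function.update_self]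
      congr 1
      exact List.map_congr_left fun r hr => Function.update_of_ne (ht r hr).symm _ _

/-- The gadget forces one of its two interface variables to be true. -/
theorem Cgad.or_eq_true {V : Type} {β : V → Bool} {x y a b c d e f g h : V}
    (H : Cgad β x y a b c d e f g h) : β x = true ∨ β y = true := by
  simp only [Cgad, clauseSat, Bool.or_eq_true, Bool.not_eq_true'] at H
  grind

/-- A satisfying assignment of the gadget in which `x` is the negation of `y`. -/
theorem Cgad.of_values {V : Type} {β : V → Bool} {x y a b c d e f g h : V} {s : Bool}
    (hx : β x = !s) (hy : β y = s) (ha : β a = false) (hb : β b = s) (hc : β c = false)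
    (hd : β d = s) (he : β e = s) (hf : β f = false) (hg : β g = !s) (hh : β h = false) :
    Cgad β x y a b c d e f g h := by
  cases s <;> simp [Cgad, clauseSat, *]

theorem stmt_19 {V : Type} (x y z u v w : V)
    (a₁ b₁ c₁ d₁ e₁ f₁ g₁ h₁ a₂ b₂ c₂ d₂ e₂ f₂ g₂ h₂ a₃ b₃ c₃ d₃ e₃ f₃ g₃ h₃ : V)
    (hdist : List.Pairwise (· ≠ ·)
      [x, y, z, u, v, w,
       a₁, b₁, c₁, d₁, e₁, f₁, g₁, h₁,
       a₂, b₂, c₂, d₂, e₂, f₂, g₂, h₂,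
       a₃, b₃, c₃, d₃, e₃, f₃, g₃, h₃])
    (βx βy βz : Bool) :
    (∃ β' : V → Bool, β' x = βx ∧ β' y = βy ∧ β' z = βz ∧
        Cgad β' u x a₁ b₁ c₁ d₁ e₁ f₁ g₁ h₁ ∧
        Cgad β' v y a₂ b₂ c₂ d₂ e₂ f₂ g₂ h₂ ∧
        Cgad β' w z a₃ b₃ c₃ d₃ e₃ f₃ g₃ h₃ ∧
        clauseSat (!β' u) (!β' v) (!β' w)) ↔
      (βx = true ∨ βy = true ∨ βz = true) := by
  constructor
  · rintro ⟨β, rfl, rfl, rfl, hx, hy, hz, huvw⟩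
    have hx := hx.or_eq_true
    have hy := hy.or_eq_true
    have hz := hz.or_eq_true
    simp only [clauseSat, Bool.or_eq_true, Bool.not_eq_true'] at huvw
    grind
  · intro hβ
    obtain ⟨β, hβ'⟩ := hdist.exists_map_eq (vs :=
      [βx, βy, βz, !βx, !βy, !βz,
       false, βx, false, βx, βx, false, !βx, false,
       false, βy, false, βy, βy, false, !βy, false,
       false, βz, false, βz, βz, false, !βz, false]) rfl
    simp only [List.map_cons, List.map_nil, List.cons.injEq, and_true] at hβ'
    obtain ⟨hx, hy, hz, hu, hv, hw, ha₁, hb₁, hc₁, hd₁, he₁, hf₁, hg₁, hh₁,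
      ha₂, hb₂, hc₂, hd₂, he₂, hf₂, hg₂, hh₂, ha₃, hb₃, hc₃, hd₃, he₃, hf₃, hg₃, hh₃⟩ := hβ'
    refine ⟨β, hx, hy, hz, .of_values hu hx ha₁ hb₁ hc₁ hd₁ he₁ hf₁ hg₁ hh₁,
      .of_values hv hy ha₂ hb₂ hc₂ hd₂ he₂ hf₂ hg₂ hh₂,
      .of_values hw hz ha₃ hb₃ hc₃ hd₃ he₃ hf₃ hg₃ hh₃, ?_⟩
    simpa [clauseSat, hu, hv, hw, or_assoc] using hβ
end
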